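/- arXiv:1003.0040 — 6 statements merged into one kernel-verified Lean document; each statement's English description precedes it below -/
import Mathlib

section
/- Let m ≥ 3, let v = (v_1,…,v_m)ᵀ ∈ V, and let (i_1⋯i_m) be a permutation of [m]. Then K_v ∩ C_{i_1⋯i_m} = ∅ if and only if all the partial sums are negative: v_{i_1} < 0, v_{i_1}+v_{i_2} < 0, …, v_{i_1}+⋯+v_{i_{m−1}} < 0. -/
open scoped BigOperators

/-- The chamber `C_{i₁⋯i_m}` of the braid arrangement restricted to
`H0 = {x : ∑ᵢ xᵢ = 0}`, associated with the permutation `σ` (where `σ k` is the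
object ranked in position `k`). -/
def braidChamber {m : ℕ} (σ : Equiv.Perm (Fin m)) :
    Set (EuclideanSpace ℝ (Fin m)) :=
  {x | (∑ i, x i = 0) ∧ ∀ k l : Fin m, k < l → x (σ l) < x (σ k)}

/-- The slicing hyperplane `K_v = {x ∈ H0 : vᵀ x = 1}`. -/
def sliceK {m : ℕ} (v : EuclideanSpace ℝ (Fin m)) :
    Set (EuclideanSpace ℝ (Fin m)) :=
  {x | (∑ i, x i = 0) ∧ ∑ i, v i * x i = 1}

/-- The set `V` of generic unit directions: `v ∈ H0`, `‖v‖ = 1`, and all sums of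
entries of `v` over nonempty proper subsets of `[m]` are nonzero. -/
def genericDirections (m : ℕ) : Set (EuclideanSpace ℝ (Fin m)) :=
  {v | (∑ i, v i = 0) ∧ ‖v‖ = 1 ∧
    ∀ I : Finset (Fin m), I.Nonempty → I ≠ Finset.univ → ∑ i ∈ I, v i ≠ 0}

theorem Fin.Iic_succ_eq_insert {n : ℕ} (k : Fin n) :
    Finset.Iic k.succ = insert k.succ (Finset.Iic k.castSucc) := by
  ext j
  simp only [Finset.mem_Iic, Finset.mem_insert, Fin.le_def, Fin.ext_iff, Fin.val_succ,
    Fin.val_castSucc]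
  omega

/-- An Abel summation inequality: if `y` is antitone and the proper partial sums of `w` are
nonpositive, then each partial sum of `w * y` is at most the last value of `y` times the partial
sum of `w`. -/
theorem Fin.sum_Iic_mul_le {n : ℕ} {w y : Fin (n + 1) → ℝ} (hy : Antitone y)
    (hw : ∀ k : Fin n, ∑ j ∈ Finset.Iic k.castSucc, w j ≤ 0) (k : Fin (n + 1)) :
    ∑ j ∈ Finset.Iic k, w j * y j ≤ (∑ j ∈ Finset.Iic k, w j) * y k := by
  induction k using Fin.induction with
  | zero =>
    have h : Finset.Iic (0 : Fin (n + 1)) = {0} := by ext j; simp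
    simp [h]
  | succ k ih =>
    have hk : k.succ ∉ Finset.Iic k.castSucc := by simp [Fin.le_def]
    rw [Fin.Iic_succ_eq_insert, Finset.sum_insert hk, Finset.sum_insert hk, add_mul]
    have h := mul_le_mul_of_nonpos_left (hy (Fin.castSucc_le_succ k)) (hw k)
    linarith

/-- If `w` has total sum zero and some initial partial sum of `w` is positive, then there is a
strictly decreasing `y` of total sum zero whose pairing with `w` equals one. -/
theorem Fin.exists_strictAnti_sum_mul_eq_one {m : ℕ} {w : Fin m → ℝ} (hw : ∑ j, w j = 0)
    (k : Fin m) (hk : 0 < ∑ j ∈ Finset.Iic k, w j) :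
    ∃ y : Fin m → ℝ, StrictAnti y ∧ ∑ j, y j = 0 ∧ ∑ j, w j * y j = 1 := by
  set S := ∑ j ∈ Finset.Iic k, w j with hS
  set A := ∑ j : Fin m, w j * (j : ℝ) with hA
  set t := (|A| + 1) / S with ht
  have htpos : 0 < t := by positivity
  have htS : t * S = |A| + 1 := div_mul_cancel₀ _ hk.ne'
  set z : Fin m → ℝ := fun j => t * (if j ≤ k then 1 else 0) - (j : ℝ) with hz
  have hz_anti : StrictAnti z := by
    intro a b hab
    have h1 : (a : ℝ) < b := by exact_mod_cast hab
    have h2 : t * (if b ≤ k then (1 : ℝ) else 0) ≤ t * (if a ≤ k then 1 else 0) := by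
      refine mul_le_mul_of_nonneg_left ?_ htpos.le
      split_ifs with hb ha
      · exact le_rfl
      · exact absurd (hab.le.trans hb) ha
      · exact zero_le_one
      · exact le_rfl
    simp only [hz]
    linarith
  have hwz : ∑ j, w j * z j = t * S - A := by
    have hSi : S = ∑ j, w j * (if j ≤ k then (1 : ℝ) else 0) := by
      simp only [mul_ite, mul_one, mul_zero, ← Finset.sum_filter]
      rw [hS]
      congr 1
      ext j
      simp
    rw [hSi, hA, Finset.mul_sum, ← Finset.sum_sub_distrib]
    exact Finset.sum_congr rfl fun j _ => by simp only [hz]; ring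
  set B := t * S - A with hB
  have hBpos : 0 < B := by
    have := le_abs_self A
    linarith
  have hm : (m : ℝ) ≠ 0 := Nat.cast_ne_zero.mpr k.pos.ne'
  set c := (∑ j, z j) / m with hc
  refine ⟨fun j => (z j - c) / B, fun a b hab => ?_, ?_, ?_⟩
  · exact div_lt_div_of_pos_right (sub_lt_sub_right (hz_anti hab) c) hBpos
  · rw [← Finset.sum_div, Finset.sum_sub_distrib]
    simp [hc, mul_div_cancel₀ _ hm]
  · have h : ∀ j, w j * ((z j - c) / B) = (w j * z j - w j * c) / B := fun j => by ring
    simp only [h]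
    rw [← Finset.sum_div, Finset.sum_sub_distrib, ← Finset.sum_mul, hw, hwz, zero_mul, sub_zero,
      div_self hBpos.ne']

/-- Lemma 3.1, first equivalence: for `v ∈ V` and a permutation `(i₁⋯i_m)`,
`K_v ∩ C_{i₁⋯i_m} = ∅` iff all proper initial partial sums
`v_{i₁} + ⋯ + v_{i_k}` (for `1 ≤ k ≤ m-1`) are negative. -/
theorem slice_inter_chamber_empty_iff {m : ℕ} (hm : 3 ≤ m)
    (v : EuclideanSpace ℝ (Fin m)) (hv : v ∈ genericDirections m)
    (σ : Equiv.Perm (Fin m)) :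
    sliceK v ∩ braidChamber σ = ∅ ↔
      ∀ k : Fin m, (k : ℕ) < m - 1 → ∑ j ∈ Finset.Iic k, v (σ j) < 0 := by
  obtain ⟨hv0, -, hgen⟩ := hv
  have hw0 : ∑ j, v (σ j) = 0 := by rw [Equiv.sum_comp σ fun i => v i, hv0]
  constructor
  · intro hempty k hk
    by_contra! hnonneg
    have hne : ∑ j ∈ Finset.Iic k, v (σ j) ≠ 0 := by
      have h := hgen ((Finset.Iic k).map σ.toEmbedding) (by simp) fun huniv => by
        have hcard := congrArg Finset.card huniv
        rw [Finset.card_map, Fin.card_Iic, Finset.card_univ, Fintype.card_fin] at hcard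
        omega
      simpa [Finset.sum_map] using h
    obtain ⟨y, hy, hy0, hy1⟩ :=
      Fin.exists_strictAnti_sum_mul_eq_one hw0 k (lt_of_le_of_ne hnonneg hne.symm)
    have hx0 : ∑ i, y (σ.symm i) = 0 := by rw [Equiv.sum_comp σ.symm y, hy0]
    have hx1 : ∑ i, v i * y (σ.symm i) = 1 := by
      rw [← Equiv.sum_comp σ]
      simpa using hy1
    have hmem : WithLp.toLp 2 (fun i => y (σ.symm i)) ∈ sliceK v ∩ braidChamber σ :=
      ⟨⟨hx0, hx1⟩, hx0, fun a b hab => by simpa using hy hab⟩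
    rw [hempty] at hmem
    exact hmem
  · intro hneg
    refine Set.eq_empty_iff_forall_notMem.mpr ?_
    rintro x ⟨⟨-, hx1⟩, -, hx⟩
    obtain ⟨n, rfl⟩ : ∃ n, m = n + 1 := ⟨m - 1, by omega⟩
    have hy : StrictAnti fun j => x (σ j) := fun a b hab => hx a b hab
    have h := Fin.sum_Iic_mul_le hy.antitone (w := fun j => v (σ j))
      (fun k => (hneg k.castSucc (by simp)).le) (Fin.last n)
    have huniv : Finset.Iic (Fin.last n) = Finset.univ := by
      ext j
      simp [Fin.le_last]
    rw [huniv, hw0, zero_mul, Equiv.sum_comp σ fun i => v i * x i, hx1] at h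
    linarith
end

section
/- Let m ≥ 3, let v = (v_1,…,v_m)ᵀ ∈ V, and let (i_1⋯i_m) be a permutation of [m]. Then K_v ∩ C_{i_1⋯i_m} is nonempty and bounded if and only if all the partial sums are positive: v_{i_1} > 0, v_{i_1}+v_{i_2} > 0, …, v_{i_1}+⋯+v_{i_{m−1}} > 0. -/
open scoped BigOperators

theorem sum_Iic_eq_sum_ite {m : ℕ} (w : Fin m → ℝ) (k : Fin m) :
    ∑ j ∈ Finset.Iic k, w j = ∑ j, if j ≤ k then w j else 0 := by
  rw [← Finset.sum_filter]
  congr 1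
  ext j
  simp

/-- Abel summation over `Fin (n + 1)`. -/
theorem sum_mul_eq_last_add_sum_Iic {n : ℕ} (w y : Fin (n + 1) → ℝ) :
    ∑ j, w j * y j = y (Fin.last n) * ∑ j, w j +
      ∑ k : Fin n, (y k.castSucc - y k.succ) * ∑ j ∈ Finset.Iic k.castSucc, w j := by
  simp only [sum_Iic_eq_sum_ite]
  induction n with
  | zero => simp [mul_comm]
  | succ n ih =>
    have h := ih (fun j => w j.castSucc) (fun j => y j.castSucc)
    have hle (k : Fin n) : ¬ Fin.last (n + 1) ≤ k.castSucc.castSucc := by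
      simp [Fin.le_def]
    have hlast : ¬ Fin.last (n + 1) ≤ (Fin.last n).castSucc := by
      simp [Fin.le_def]
    rw [Fin.sum_univ_castSucc, h, Fin.sum_univ_castSucc (f := w),
      Fin.sum_univ_castSucc (n := n) (f := fun k => (y k.castSucc - y k.succ) * _)]
    simp only [Fin.sum_univ_castSucc (n := n + 1), hle, hlast, Fin.castSucc_le_castSucc_iff,
      Fin.le_last, if_true, if_false, add_zero, Fin.succ_castSucc, Fin.succ_last]
    ring

/-- Translating by a constant moves any vector into the sum-zero hyperplane. -/
noncomputable def centered {m : ℕ} (f : Fin m → ℝ) : EuclideanSpace ℝ (Fin m) :=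
  WithLp.toLp 2 fun i => f i - (∑ j, f j) / m

theorem centered_apply {m : ℕ} (f : Fin m → ℝ) (i : Fin m) :
    centered f i = f i - (∑ j, f j) / m := rfl

theorem sum_centered {m : ℕ} (hm : m ≠ 0) (f : Fin m → ℝ) : ∑ i, centered f i = 0 := by
  have : (m : ℝ) ≠ 0 := Nat.cast_ne_zero.mpr hm
  simp only [centered_apply, Finset.sum_sub_distrib, Finset.sum_const, Finset.card_univ,
    Fintype.card_fin, nsmul_eq_mul]
  field_simp
  ring

theorem sum_mul_centered {m : ℕ} (v f : Fin m → ℝ) (hv : ∑ i, v i = 0) :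
    ∑ i, v i * centered f i = ∑ i, v i * f i := by
  simp only [centered_apply, mul_sub, Finset.sum_sub_distrib, ← Finset.sum_mul, hv]
  ring

theorem sum_mul_eq_sum_gap_mul {n : ℕ} (v x : Fin (n + 1) → ℝ) (hv : ∑ i, v i = 0)
    (σ : Equiv.Perm (Fin (n + 1))) :
    ∑ i, v i * x i = ∑ k : Fin n, (x (σ k.castSucc) - x (σ k.succ)) *
      ∑ j ∈ Finset.Iic k.castSucc, v (σ j) := by
  rw [← Equiv.sum_comp σ (fun i => v i * x i),
    sum_mul_eq_last_add_sum_Iic (fun j => v (σ j)) (fun j => x (σ j)),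
    Equiv.sum_comp σ v, hv, mul_zero, zero_add]

theorem sum_mul_initial_indicator {m : ℕ} (v : Fin m → ℝ) (σ : Equiv.Perm (Fin m)) (k : Fin m) :
    ∑ i, v i * (if σ.symm i ≤ k then 1 else 0) = ∑ j ∈ Finset.Iic k, v (σ j) := by
  rw [← Equiv.sum_comp σ, sum_Iic_eq_sum_ite]
  simp

theorem slice_inter_chamber_nonempty {n : ℕ} (hn : 0 < n) (v : EuclideanSpace ℝ (Fin (n + 1)))
    (hv : ∑ i, v i = 0) (σ : Equiv.Perm (Fin (n + 1)))
    (hS : ∀ k : Fin n, 0 < ∑ j ∈ Finset.Iic k.castSucc, v (σ j)) :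
    (sliceK v ∩ braidChamber σ).Nonempty := by
  set S := ∑ k : Fin n, ∑ j ∈ Finset.Iic k.castSucc, v (σ j) with hSdef
  have hpos : 0 < S := Finset.sum_pos (fun k _ => hS k) ⟨⟨0, hn⟩, Finset.mem_univ _⟩
  have hsum := sum_centered n.succ_ne_zero fun i => -((σ.symm i : ℕ) : ℝ) / S
  refine ⟨centered fun i => -((σ.symm i : ℕ) : ℝ) / S, ⟨hsum, ?_⟩, hsum, ?_⟩
  · rw [sum_mul_eq_sum_gap_mul v _ hv σ]
    have h (k : Fin n) : (centered fun i => -((σ.symm i : ℕ) : ℝ) / S) (σ k.castSucc) -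
        (centered fun i => -((σ.symm i : ℕ) : ℝ) / S) (σ k.succ) = 1 / S := by
      simp only [centered_apply, Equiv.symm_apply_apply, Fin.val_castSucc, Fin.val_succ]
      push_cast
      ring
    simp only [h]
    rw [← Finset.mul_sum, ← hSdef]
    field_simp
  · intro k l hkl
    simp only [centered_apply, Equiv.symm_apply_apply]
    have : ((k : ℕ) : ℝ) < ((l : ℕ) : ℝ) := by exact_mod_cast hkl
    gcongr

theorem slice_inter_chamber_bounded {n : ℕ} (v : EuclideanSpace ℝ (Fin (n + 1)))
    (hv : ∑ i, v i = 0) (σ : Equiv.Perm (Fin (n + 1)))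
    (hS : ∀ k : Fin n, 0 < ∑ j ∈ Finset.Iic k.castSucc, v (σ j)) :
    Bornology.IsBounded (sliceK v ∩ braidChamber σ) := by
  set B := ∑ k : Fin n, (∑ j ∈ Finset.Iic k.castSucc, v (σ j))⁻¹ with hB
  refine isBounded_iff_forall_norm_le.mpr ⟨√(∑ _i : Fin (n + 1), B ^ 2), ?_⟩
  rintro x ⟨⟨hx0, hx1⟩, -, hx⟩
  have hgap (k : Fin n) : 0 < x (σ k.castSucc) - x (σ k.succ) :=
    sub_pos.mpr (hx _ _ k.castSucc_lt_succ)
  rw [sum_mul_eq_sum_gap_mul v x hv σ] at hx1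
  have hgap_le (k : Fin n) : x (σ k.castSucc) - x (σ k.succ) ≤
      (∑ j ∈ Finset.Iic k.castSucc, v (σ j))⁻¹ := by
    rw [← one_div, le_div_iff₀ (hS k), ← hx1]
    exact Finset.single_le_sum (f := fun k : Fin n => (x (σ k.castSucc) - x (σ k.succ)) *
      ∑ j ∈ Finset.Iic k.castSucc, v (σ j))
      (fun k _ => (mul_pos (hgap k) (hS k)).le) (Finset.mem_univ k)
  have hspread : x (σ 0) - x (σ (Fin.last n)) ≤ B := by
    have h1 := Fin.sum_univ_castSucc fun j => x (σ j)
    have h2 := Fin.sum_univ_succ fun j => x (σ j)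
    have h3 : ∑ k : Fin n, (x (σ k.castSucc) - x (σ k.succ)) ≤ B :=
      Finset.sum_le_sum fun k _ => hgap_le k
    rw [Finset.sum_sub_distrib] at h3
    linarith
  have hanti : Antitone fun j => x (σ j) := by
    refine StrictAnti.antitone fun k l hkl => hx k l hkl
  have htop (i : Fin (n + 1)) : x i ≤ x (σ 0) := by
    simpa using hanti (Fin.zero_le (σ.symm i))
  have hbot (i : Fin (n + 1)) : x (σ (Fin.last n)) ≤ x i := by
    simpa using hanti (Fin.le_last (σ.symm i))
  obtain ⟨i, -, hi⟩ := Finset.exists_le_of_sum_le (s := Finset.univ) (f := fun i => x i)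
    (g := fun _ => 0) Finset.univ_nonempty (by simp [hx0])
  obtain ⟨j, -, hj⟩ := Finset.exists_le_of_sum_le (s := Finset.univ) (f := fun _ => (0 : ℝ))
    (g := fun i => x i) Finset.univ_nonempty (by simp [hx0])
  rw [EuclideanSpace.norm_eq]
  refine Real.sqrt_le_sqrt (Finset.sum_le_sum fun l _ => ?_)
  refine pow_le_pow_left₀ (norm_nonneg _) ?_ 2
  rw [Real.norm_eq_abs, abs_le]
  constructor <;> linarith [htop l, hbot l, htop j, hbot i]

theorem initial_sum_nonneg_of_bounded {n : ℕ} (v : EuclideanSpace ℝ (Fin (n + 1)))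
    (hv : ∑ i, v i = 0) (σ : Equiv.Perm (Fin (n + 1)))
    (hne : (sliceK v ∩ braidChamber σ).Nonempty)
    (hbdd : Bornology.IsBounded (sliceK v ∩ braidChamber σ)) (k : Fin n) :
    0 ≤ ∑ j ∈ Finset.Iic k.castSucc, v (σ j) := by
  by_contra! hk
  obtain ⟨x, ⟨hx0, hx1⟩, -, hx⟩ := hne
  obtain ⟨l, hl⟩ : ∃ l : Fin n, 0 < ∑ j ∈ Finset.Iic l.castSucc, v (σ j) := by
    by_contra! h
    have h1 := sum_mul_eq_sum_gap_mul v x hv σ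
    have h2 := Finset.sum_nonpos fun (l : Fin n) (_ : l ∈ Finset.univ) =>
      mul_nonpos_of_nonneg_of_nonpos (sub_pos.mpr (hx _ _ l.castSucc_lt_succ)).le (h l)
    linarith
  obtain ⟨M, hM⟩ := isBounded_iff_forall_norm_le.mp hbdd
  set Sk := ∑ j ∈ Finset.Iic k.castSucc, v (σ j) with hSk
  set Sl := ∑ j ∈ Finset.Iic l.castSucc, v (σ j) with hSl
  let f : Fin (n + 1) → ℝ := fun i =>
    Sl * (if σ.symm i ≤ k.castSucc then 1 else 0) - Sk * (if σ.symm i ≤ l.castSucc then 1 else 0)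
  have hf : Antitone fun j => f (σ j) := by
    intro a b hab
    have hind (c : Fin (n + 1)) : (if b ≤ c then (1 : ℝ) else 0) ≤ if a ≤ c then 1 else 0 := by
      split_ifs with h1 h2
      · exact le_rfl
      · exact absurd (hab.trans h1) h2
      · exact zero_le_one
      · exact le_rfl
    simp only [f, Equiv.symm_apply_apply]
    nlinarith [hind k.castSucc, hind l.castSucc]
  have hfgap : Sl ≤ f (σ k.castSucc) - f (σ k.succ) := by
    have h1 : ¬ k.succ ≤ k.castSucc := not_le.mpr k.castSucc_lt_succ
    simp only [f, Equiv.symm_apply_apply, le_refl, h1, if_true, if_false]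
    split_ifs with h2 h3 h3
    · linarith
    · linarith
    · exact absurd (k.castSucc_lt_succ.le.trans h3) h2
    · linarith
  have hvf : ∑ i, v i * f i = 0 := by
    have h1 := sum_mul_initial_indicator v σ k.castSucc
    have h2 := sum_mul_initial_indicator v σ l.castSucc
    have : ∑ i, v i * f i = Sl * (∑ i, v i * (if σ.symm i ≤ k.castSucc then 1 else 0)) -
        Sk * ∑ i, v i * (if σ.symm i ≤ l.castSucc then 1 else 0) := by
      rw [Finset.mul_sum, Finset.mul_sum, ← Finset.sum_sub_distrib]
      exact Finset.sum_congr rfl fun i _ => by simp only [f]; ring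
    rw [this, h1, h2, ← hSk, ← hSl]
    ring
  have hM0 : 0 ≤ M := (norm_nonneg x).trans (hM x ⟨⟨hx0, hx1⟩, hx0, hx⟩)
  set t := (2 * M + 1) / Sl with ht
  have ht0 : 0 < t := by positivity
  have htS : t * Sl = 2 * M + 1 := by rw [ht]; field_simp
  set z := x + t • centered f with hz
  have hzapp (i : Fin (n + 1)) : z i = x i + t * centered f i := by simp [hz]
  have hz0 : ∑ i, z i = 0 := by
    simp only [hzapp, Finset.sum_add_distrib, ← Finset.mul_sum, hx0,
      sum_centered n.succ_ne_zero f, mul_zero, add_zero]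
  have hz1 : ∑ i, v i * z i = 1 := by
    have : ∑ i, v i * z i = ∑ i, v i * x i + t * ∑ i, v i * centered f i := by
      rw [Finset.mul_sum, ← Finset.sum_add_distrib]
      exact Finset.sum_congr rfl fun i _ => by rw [hzapp]; ring
    rw [this, sum_mul_centered v f hv, hvf, hx1, mul_zero, add_zero]
  have hzC : ∀ a b : Fin (n + 1), a < b → z (σ b) < z (σ a) := by
    intro a b hab
    have h1 := hx a b hab
    have h2 : f (σ b) ≤ f (σ a) := hf hab.le
    rw [hzapp, hzapp, centered_apply, centered_apply]
    nlinarith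
  have hzM := hM z ⟨⟨hz0, hz1⟩, hz0, hzC⟩
  have habs (i : Fin (n + 1)) : |z i| ≤ M := (PiLp.norm_apply_le z i).trans hzM
  have ha := (abs_le.mp (habs (σ k.castSucc))).2
  have hb := (abs_le.mp (habs (σ k.succ))).1
  have hxk := hx _ _ k.castSucc_lt_succ
  rw [hzapp, centered_apply] at ha hb
  nlinarith [mul_le_mul_of_nonneg_left hfgap ht0.le]

/-- Lemma 3.1, second equivalence: for `v ∈ V` and a permutation `(i₁⋯i_m)`,
`K_v ∩ C_{i₁⋯i_m}` is nonempty and bounded iff all proper initial partial sums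
`v_{i₁} + ⋯ + v_{i_k}` (for `1 ≤ k ≤ m-1`) are positive. -/
theorem slice_inter_chamber_bounded_iff {m : ℕ} (hm : 3 ≤ m)
    (v : EuclideanSpace ℝ (Fin m)) (hv : v ∈ genericDirections m)
    (σ : Equiv.Perm (Fin m)) :
    ((sliceK v ∩ braidChamber σ).Nonempty ∧
        Bornology.IsBounded (sliceK v ∩ braidChamber σ)) ↔
      ∀ k : Fin m, (k : ℕ) < m - 1 → 0 < ∑ j ∈ Finset.Iic k, v (σ j) := by
  obtain ⟨n, rfl⟩ : ∃ n, m = n + 1 := ⟨m - 1, by omega⟩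
  obtain ⟨hv0, -, hgen⟩ := hv
  constructor
  · rintro ⟨hne, hbdd⟩ k hk
    obtain ⟨k, rfl⟩ : ∃ l : Fin n, l.castSucc = k := ⟨⟨k, by omega⟩, rfl⟩
    refine lt_of_le_of_ne (initial_sum_nonneg_of_bounded v hv0 σ hne hbdd k) (Ne.symm ?_)
    have h := hgen ((Finset.Iic k.castSucc).map σ.toEmbedding)
      ((Finset.map_nonempty).mpr ⟨_, Finset.mem_Iic.mpr le_rfl⟩) fun h => by
        have := h ▸ Finset.mem_univ (σ k.succ)
        simp at this
    simpa using h
  · intro h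
    have hS (k : Fin n) : 0 < ∑ j ∈ Finset.Iic k.castSucc, v (σ j) := h k.castSucc (by simp)
    exact ⟨slice_inter_chamber_nonempty (by omega) v hv0 σ hS,
      slice_inter_chamber_bounded v hv0 σ hS⟩
end

section
/- Let m ≥ 3, let v = (v_1,…,v_m)ᵀ ∈ V, and let (i_1⋯i_m) be a permutation of [m]. Then K_v ∩ C_{i_1⋯i_m} is an unbounded set if and only if there exist k, l ∈ [m−1] with k ≠ l such that (v_{i_1}+⋯+v_{i_k})(v_{i_1}+⋯+v_{i_l}) < 0. -/
open scoped BigOperators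

/-- A summation-by-parts lower bound: if `y` is antitone on `{0, …, n}` and the partial sums of `a`
before `n` are at least `ε`, then `∑ a j * y j` dominates `ε` times the total drop of `y`, up to a
boundary term. -/
lemma le_sum_mul_of_le_partialSums {a y : ℕ → ℝ} {ε : ℝ} (n : ℕ)
    (hy : ∀ k < n, y (k + 1) ≤ y k)
    (ha : ∀ k < n, ε ≤ ∑ j ∈ Finset.range (k + 1), a j) :
    ε * (y 0 - y n) + (∑ j ∈ Finset.range (n + 1), a j) * y n ≤
      ∑ j ∈ Finset.range (n + 1), a j * y j := by
  induction n with
  | zero => simp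
  | succ n ih =>
    have h := ih (fun k hk => hy k (by omega)) (fun k hk => ha k (by omega))
    rw [Finset.sum_range_succ (fun j => a j * y j) (n + 1), Finset.sum_range_succ a (n + 1)]
    nlinarith [mul_le_mul_of_nonneg_right (ha n (by omega)) (sub_nonneg.2 (hy n (by omega)))]

/-- The version of `le_sum_mul_of_le_partialSums` for sequences of total sum zero indexed by
`Fin (n + 1)`. -/
lemma mul_sub_le_sum_mul_of_le_partialSums {n : ℕ} {a y : Fin (n + 1) → ℝ} {ε : ℝ}
    (hy : Antitone y) (ha : ∀ k, k ≠ Fin.last n → ε ≤ ∑ j ∈ Finset.Iic k, a j)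
    (hsum : ∑ j, a j = 0) :
    ε * (y 0 - y (Fin.last n)) ≤ ∑ j, a j * y j := by
  have hlt : ∀ k : ℕ, k ≤ n → k < n + 1 := fun k hk => by omega
  have hval : ∀ j : Fin (n + 1), Fin.ofNat (n + 1) j = j := fun j => by simp
  have hpart : ∀ k : Fin (n + 1),
      ∑ j ∈ Finset.range (k + 1), a (Fin.ofNat (n + 1) j) = ∑ j ∈ Finset.Iic k, a j := by
    intro k
    have hset : Finset.range (k + 1) = (Finset.Iic k).map Fin.valEmbedding := by
      ext j
      simp only [Finset.mem_range, Fin.map_valEmbedding_Iic, Finset.mem_Iic]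
      omega
    rw [hset, Finset.sum_map]
    simp
  have h := le_sum_mul_of_le_partialSums (a := fun j => a (Fin.ofNat (n + 1) j))
    (y := fun j => y (Fin.ofNat (n + 1) j)) (ε := ε) n
    (fun k hk => hy (by
      rw [Fin.le_def]
      simp [Nat.mod_eq_of_lt (hlt k hk.le), Nat.mod_eq_of_lt (hlt (k + 1) hk)]))
    (fun k hk => by
      have hk' := hpart ⟨k, by omega⟩
      rw [hk']
      exact ha _ (by simp [Fin.ext_iff]; omega))
  rw [← Fin.sum_univ_eq_sum_range, ← Fin.sum_univ_eq_sum_range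
    (fun j => a (Fin.ofNat (n + 1) j) * y (Fin.ofNat (n + 1) j))] at h
  simp only [hval, hsum, zero_mul, add_zero] at h
  have hlast : Fin.ofNat (n + 1) n = Fin.last n := hval (Fin.last n)
  have hzero : Fin.ofNat (n + 1) 0 = 0 := hval 0
  rwa [hlast, hzero] at h

/-- The proper partial sums of a generic direction do not vanish. -/
lemma sum_Iic_ne_zero_of_mem_genericDirections {n : ℕ} {v : EuclideanSpace ℝ (Fin (n + 1))}
    (hv : v ∈ genericDirections (n + 1)) (σ : Equiv.Perm (Fin (n + 1))) {k : Fin (n + 1)}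
    (hk : k ≠ Fin.last n) : ∑ j ∈ Finset.Iic k, v (σ j) ≠ 0 := by
  have h := hv.2.2 ((Finset.Iic k).map σ.toEmbedding) (by simp) (fun h => by
    have hmem := Finset.mem_univ (σ (Fin.last n))
    rw [← h] at hmem
    simp only [Finset.mem_map_equiv, Equiv.symm_apply_apply, Finset.mem_Iic] at hmem
    exact hk (Fin.last_le_iff.1 hmem))
  simpa using h

/-- If the proper partial sums of `v` along `σ` are bounded below by a positive number, then the
slice of the chamber `σ` is bounded. -/
lemma isBounded_slice_inter_chamber_of_le {n : ℕ} {v : EuclideanSpace ℝ (Fin (n + 1))}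
    {σ : Equiv.Perm (Fin (n + 1))} (hv : ∑ i, v i = 0) {ε : ℝ} (hε : 0 < ε)
    (h : ∀ k, k ≠ Fin.last n → ε ≤ ∑ j ∈ Finset.Iic k, v (σ j)) :
    Bornology.IsBounded (sliceK v ∩ braidChamber σ) := by
  refine ((EuclideanSpace.equiv (Fin (n + 1)) ℝ).antilipschitz.isBounded_preimage
    (Metric.isBounded_closedBall (x := 0) (r := 1 / ε))).subset ?_
  rintro x ⟨⟨hx0, hx⟩, -, hc⟩
  have hanti : Antitone (fun j => x (σ j)) :=
    (show StrictAnti (fun j => x (σ j)) from fun k l hkl => hc k l hkl).antitone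
  have key := mul_sub_le_sum_mul_of_le_partialSums (a := fun j => v (σ j)) hanti h
    (by rw [Equiv.sum_comp σ (fun i => v i), hv])
  rw [Equiv.sum_comp σ (fun i => v i * x i), hx, mul_comm, ← le_div_iff₀ hε] at key
  rw [← Equiv.sum_comp σ] at hx0
  have hfirst : 0 ≤ x (σ 0) := by
    by_contra! hlt
    exact (Finset.sum_neg (fun j _ => (hanti (Fin.zero_le j)).trans_lt hlt)
      Finset.univ_nonempty).ne hx0
  have hend : x (σ (Fin.last n)) ≤ 0 := by
    by_contra! hlt
    exact (Finset.sum_pos (fun j _ => hlt.trans_le (hanti (Fin.le_last j)))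
      Finset.univ_nonempty).ne' hx0
  rw [Set.mem_preimage, mem_closedBall_zero_iff, pi_norm_le_iff_of_nonneg (by positivity)]
  intro i
  obtain ⟨j, rfl⟩ := σ.surjective i
  have h₁ := hanti (Fin.zero_le j)
  have h₂ := hanti (Fin.le_last j)
  change |x (σ j)| ≤ 1 / ε
  rw [abs_le]
  dsimp only at h₁ h₂
  constructor <;> linarith

/-- If no proper partial sum of `v` along `σ` is positive, then `v` pairs nonpositively with every
point of the chamber `σ`, so the slice is empty. -/
lemma slice_inter_chamber_eq_empty_of_nonpos {n : ℕ} {v : EuclideanSpace ℝ (Fin (n + 1))}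
    {σ : Equiv.Perm (Fin (n + 1))} (hv : ∑ i, v i = 0)
    (h : ∀ k, k ≠ Fin.last n → ∑ j ∈ Finset.Iic k, v (σ j) ≤ 0) :
    sliceK v ∩ braidChamber σ = ∅ := by
  rw [Set.eq_empty_iff_forall_notMem]
  rintro x ⟨⟨-, hx⟩, -, hc⟩
  have hanti : Antitone (fun j => x (σ j)) :=
    (show StrictAnti (fun j => x (σ j)) from fun k l hkl => hc k l hkl).antitone
  have key := mul_sub_le_sum_mul_of_le_partialSums (a := fun j => - v (σ j)) (ε := 0) hanti
    (fun k hk => by simpa using h k hk) (by simp [Equiv.sum_comp σ (fun i => v i), hv])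
  simp only [neg_mul, Finset.sum_neg_distrib, zero_mul,
    Equiv.sum_comp σ (fun i => v i * x i), hx] at key
  linarith

/-- If some partial sum of `v` along `σ` is positive and another one is negative, then the slice
of the chamber `σ` is unbounded. -/
lemma not_isBounded_slice_inter_chamber {n : ℕ} {v : EuclideanSpace ℝ (Fin (n + 1))}
    {σ : Equiv.Perm (Fin (n + 1))} (hv : ∑ i, v i = 0) {k l : Fin (n + 1)}
    (hk : 0 < ∑ j ∈ Finset.Iic k, v (σ j)) (hl : ∑ j ∈ Finset.Iic l, v (σ j) < 0) :
    ¬ Bornology.IsBounded (sliceK v ∩ braidChamber σ) := by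
  have hkn : k ≠ Fin.last n := by
    rintro rfl
    have htop : Finset.Iic (Fin.last n) = Finset.univ := by ext; simp [Fin.le_last]
    rw [htop, Equiv.sum_comp σ (fun i => v i), hv] at hk
    exact lt_irrefl _ hk
  set S := ∑ j ∈ Finset.Iic k, v (σ j) with hS
  set T := ∑ j ∈ Finset.Iic l, v (σ j) with hT
  set b : ℝ := ∑ j, v (σ j) * -(j : ℝ) with hb
  intro hbd
  obtain ⟨R, hR⟩ := hbd.exists_norm_le
  set α : ℝ := (|1 - b| + 2 * |R| * S) / S with hα
  set β : ℝ := (|1 - b| + 2 * |R| * S - (1 - b)) / (-T) with hβ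
  have hαR : 2 * R ≤ α := by
    rw [hα, le_div_iff₀ hk]
    nlinarith [le_abs_self R, abs_nonneg (1 - b)]
  have hα0 : 0 ≤ α := by positivity
  have hβ0 : 0 ≤ β := by
    apply div_nonneg _ (by linarith)
    nlinarith [le_abs_self (1 - b), mul_nonneg (abs_nonneg R) hk.le]
  have hαβ : b + α * S + β * T = 1 := by
    rw [hα, hβ]
    field_simp [hk.ne', hl.ne]
    ring
  let z : Fin (n + 1) → ℝ := fun j =>
    -(j : ℝ) + (if j ≤ k then α else 0) + (if j ≤ l then β else 0)
  let c : ℝ := (∑ j, z j) / (n + 1)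
  let x : EuclideanSpace ℝ (Fin (n + 1)) := WithLp.toLp 2 (fun i => z (σ.symm i) - c)
  have hxσ : ∀ j, x (σ j) = z j - c := fun j => by simp [x]
  have hx0 : ∑ i, x i = 0 := by
    rw [← Equiv.sum_comp σ]
    simp only [hxσ, Finset.sum_sub_distrib, Finset.sum_const, Finset.card_univ, Fintype.card_fin,
      nsmul_eq_mul, c]
    push_cast
    field_simp
    ring
  have hx1 : ∑ i, v i * x i = 1 := by
    rw [← Equiv.sum_comp σ]
    have hSα : ∑ j, v (σ j) * (if j ≤ k then α else 0) = α * S := by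
      simp [mul_ite, ← Finset.sum_filter, hS, Finset.sum_mul, mul_comm _ (∑ _ ∈ _, _),
        Finset.filter_ge_eq_Iic]
    have hTβ : ∑ j, v (σ j) * (if j ≤ l then β else 0) = β * T := by
      simp [mul_ite, ← Finset.sum_filter, hT, Finset.sum_mul, mul_comm _ (∑ _ ∈ _, _),
        Finset.filter_ge_eq_Iic]
    have hc0 : ∑ j, v (σ j) * c = 0 := by
      rw [← Finset.sum_mul, Equiv.sum_comp σ (fun i => v i), hv, zero_mul]
    simp only [hxσ, z, mul_sub, mul_add, Finset.sum_sub_distrib, Finset.sum_add_distrib, hSα, hTβ,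
      hc0, sub_zero]
    exact hαβ
  have hxc : ∀ p q : Fin (n + 1), p < q → x (σ q) < x (σ p) := by
    intro p q hpq
    have hpq' : (p : ℝ) < q := by exact_mod_cast hpq
    have step : ∀ (r : Fin (n + 1)) (γ : ℝ), 0 ≤ γ →
        (if q ≤ r then γ else 0) ≤ (if p ≤ r then γ else 0) := by
      intro r γ hγ
      by_cases hq : q ≤ r
      · simp [hq, hpq.le.trans hq]
      · rw [if_neg hq]
        split_ifs <;> simp [hγ]
    rw [hxσ, hxσ]
    simp only [z]
    linarith [step k α hα0, step l β hβ0]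
  have hmem := hR x ⟨⟨hx0, hx1⟩, hx0, hxc⟩
  have h₁ := (PiLp.norm_apply_le x (σ k)).trans hmem
  have h₂ := (PiLp.norm_apply_le x (σ (Fin.last n))).trans hmem
  rw [Real.norm_eq_abs, abs_le, hxσ] at h₁ h₂
  have hklt : k < Fin.last n := lt_of_le_of_ne (Fin.le_last k) hkn
  have hkn' : (k : ℝ) < n := by exact_mod_cast hklt
  have hz : z k - z (Fin.last n) = n - k + α +
      ((if k ≤ l then β else 0) - (if Fin.last n ≤ l then β else 0)) := by
    simp only [z, le_refl, if_true, if_neg hklt.not_ge, Fin.val_last]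
    ring
  have hβk : (if Fin.last n ≤ l then β else 0) ≤ (if k ≤ l then β else 0) := by
    by_cases hq : Fin.last n ≤ l
    · simp [hq, hklt.le.trans hq]
    · rw [if_neg hq]
      split_ifs <;> simp [hβ0]
  linarith [h₁.2, h₂.1]

/-- Lemma 3.1, third equivalence: for `v ∈ V` and a permutation `(i₁⋯i_m)`,
`K_v ∩ C_{i₁⋯i_m}` is unbounded iff there exist `k ≠ l` in `[m-1]` such that the
partial sums `v_{i₁} + ⋯ + v_{i_k}` and `v_{i₁} + ⋯ + v_{i_l}` have opposite
signs. -/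
theorem slice_inter_chamber_unbounded_iff {m : ℕ} (hm : 3 ≤ m)
    (v : EuclideanSpace ℝ (Fin m)) (hv : v ∈ genericDirections m)
    (σ : Equiv.Perm (Fin m)) :
    ¬ Bornology.IsBounded (sliceK v ∩ braidChamber σ) ↔
      ∃ k l : Fin m, k ≠ l ∧ (k : ℕ) < m - 1 ∧ (l : ℕ) < m - 1 ∧
        (∑ j ∈ Finset.Iic k, v (σ j)) * (∑ j ∈ Finset.Iic l, v (σ j)) < 0 := by
  obtain ⟨n, rfl⟩ : ∃ n, m = n + 1 := ⟨m - 1, by omega⟩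
  have hlast : ∀ k : Fin (n + 1), (k : ℕ) < n + 1 - 1 ↔ k ≠ Fin.last n := fun k => by
    rw [ne_eq, Fin.ext_iff, Fin.val_last]
    omega
  constructor
  · contrapose!
    intro h
    by_cases hneg : ∃ l, l ≠ Fin.last n ∧ ∑ j ∈ Finset.Iic l, v (σ j) < 0
    · obtain ⟨l, hl, hl0⟩ := hneg
      rw [slice_inter_chamber_eq_empty_of_nonpos hv.1 (fun k hk => ?_)]
      · exact Bornology.isBounded_empty
      · rcases eq_or_ne k l with rfl | hkl
        · exact hl0.le
        · exact nonpos_of_mul_nonneg_left (h k l hkl ((hlast k).2 hk) ((hlast l).2 hl)) hl0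
    · push Not at hneg
      have hne : (Finset.univ.erase (Fin.last n)).Nonempty :=
        ⟨0, by simp [Fin.ext_iff]; omega⟩
      obtain ⟨k₀, hk₀, hmin⟩ := Finset.exists_min_image _
        (fun k => ∑ j ∈ Finset.Iic k, v (σ j)) hne
      have hk₀' := Finset.ne_of_mem_erase hk₀
      refine isBounded_slice_inter_chamber_of_le hv.1
        ((hneg k₀ hk₀').lt_of_ne' (sum_Iic_ne_zero_of_mem_genericDirections hv σ hk₀'))
        (fun k hk => hmin k (by simp [hk]))
  · rintro ⟨k, l, -, -, -, h⟩
    rcases mul_neg_iff.1 h with ⟨hk, hl⟩ | ⟨hk, hl⟩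
    · exact not_isBounded_slice_inter_chamber hv.1 hk hl
    · exact not_isBounded_slice_inter_chamber hv.1 hl hk
end

section
/- Let m ≥ 3 and let v ∈ V. Then the number of permutations of [m] that do not belong to RP(v) is exactly (m−1)!; equivalently, RP(v) has cardinality m! − (m−1)!. -/
open scoped BigOperators

/-- The ranking pattern of the braid slice by `K_v`: the set of permutations
whose chamber meets `K_v`. -/
def rankingPattern {m : ℕ} (v : EuclideanSpace ℝ (Fin m)) :
    Set (Equiv.Perm (Fin m)) :=
  {σ | (sliceK v ∩ braidChamber σ).Nonempty}

/-- The partial sums of `v` along `σ`, read cyclically. -/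
noncomputable def cyclicPartialSum {m : ℕ} [NeZero m] (v : EuclideanSpace ℝ (Fin m))
    (σ : Equiv.Perm (Fin m)) (k : ℕ) : ℝ :=
  ∑ j ∈ Finset.range k, v (σ (Fin.ofNat m j))

/-- The permutations along which all proper partial sums of `v` are negative. -/
def negativeOrders {m : ℕ} [NeZero m] (v : EuclideanSpace ℝ (Fin m)) :
    Set (Equiv.Perm (Fin m)) :=
  {σ | ∀ k, 0 < k → k < m → cyclicPartialSum v σ k < 0}

section

variable {m : ℕ} [NeZero m] {v : EuclideanSpace ℝ (Fin m)}

lemma sum_range_ofNat_eq_sum (f : Fin m → ℝ) :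
    ∑ j ∈ Finset.range m, f (Fin.ofNat m j) = ∑ i, f i := by
  rw [← Fin.sum_univ_eq_sum_range (fun j => f (Fin.ofNat m j))]
  simp

lemma sum_filter_perm_eq_cyclicPartialSum (σ : Equiv.Perm (Fin m)) {k : ℕ} (hk : k ≤ m) :
    ∑ i ∈ Finset.univ.filter (fun i : Fin m => (i : ℕ) < k), v (σ i) = cyclicPartialSum v σ k := by
  rw [cyclicPartialSum, Finset.sum_filter,
    ← sum_range_ofNat_eq_sum (fun i => if (i : ℕ) < k then v (σ i) else 0),
    ← Finset.sum_subset (Finset.range_subset_range.2 hk)]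
  · refine Finset.sum_congr rfl fun j hj => ?_
    have hj := Finset.mem_range.1 hj
    simp [Nat.mod_eq_of_lt (hj.trans_le hk), hj]
  · intro j hj hjk
    have hj := Finset.mem_range.1 hj
    simp only [Finset.mem_range] at hjk
    simp [Nat.mod_eq_of_lt hj, hjk]

lemma cyclicPartialSum_self (hv : v ∈ genericDirections m) (σ : Equiv.Perm (Fin m)) :
    cyclicPartialSum v σ m = 0 := by
  rw [cyclicPartialSum, sum_range_ofNat_eq_sum (fun i => v (σ i)), Equiv.sum_comp σ (fun i => v i)]
  exact hv.1

lemma cyclicPartialSum_ne_zero (hv : v ∈ genericDirections m) (σ : Equiv.Perm (Fin m)) {k : ℕ}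
    (hk0 : 0 < k) (hk : k < m) : cyclicPartialSum v σ k ≠ 0 := by
  rw [← sum_filter_perm_eq_cyclicPartialSum σ hk.le]
  have h := hv.2.2 ((Finset.univ.filter fun i : Fin m => (i : ℕ) < k).map σ.toEmbedding)
    ⟨σ ⟨0, hk0.trans hk⟩, by simp [hk0]⟩ (fun h => by
      have := h ▸ Finset.mem_univ (σ ⟨k, hk⟩)
      simp at this)
  simpa using h

lemma cyclicPartialSum_add_self (hv : v ∈ genericDirections m) (σ : Equiv.Perm (Fin m)) (k : ℕ) :
    cyclicPartialSum v σ (m + k) = cyclicPartialSum v σ k := by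
  have h := cyclicPartialSum_self hv σ
  unfold cyclicPartialSum at h ⊢
  rw [Finset.sum_range_add, h, zero_add]
  refine Finset.sum_congr rfl fun j _ => ?_
  refine congrArg (fun i => v (σ i)) (Fin.ext ?_)
  simp

lemma cyclicPartialSum_rotate (σ : Equiv.Perm (Fin m)) (c : Fin m) (k : ℕ) :
    cyclicPartialSum v ((Equiv.addRight c).trans σ) k =
      cyclicPartialSum v σ (c + k) - cyclicPartialSum v σ c := by
  unfold cyclicPartialSum
  rw [Finset.sum_range_add, add_sub_cancel_left]
  refine Finset.sum_congr rfl fun j _ => ?_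
  simp only [Equiv.trans_apply, Equiv.coe_addRight]
  refine congrArg (fun i => v (σ i)) (Fin.ext ?_)
  simp [Fin.val_add, add_comm]

lemma not_lt_of_rotate_mem_negativeOrders (hv : v ∈ genericDirections m)
    {σ : Equiv.Perm (Fin m)} {c d : Fin m}
    (hc : (Equiv.addRight c).trans σ ∈ negativeOrders v)
    (hd : (Equiv.addRight d).trans σ ∈ negativeOrders v) : ¬ c < d := by
  intro hcd
  have hcd : (c : ℕ) < d := hcd
  have hdm := d.isLt
  have h₁ := hc (d - c) (by omega) (by omega)
  have h₂ := hd (m + c - d) (by omega) (by omega)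
  rw [cyclicPartialSum_rotate, show (c : ℕ) + (d - c) = d by omega] at h₁
  rw [cyclicPartialSum_rotate, show (d : ℕ) + (m + c - d) = m + c by omega,
    cyclicPartialSum_add_self hv] at h₂
  linarith

/-- The cycle lemma: exactly one rotation of each order has all proper partial sums negative. -/
lemma existsUnique_rotate_mem_negativeOrders (hv : v ∈ genericDirections m)
    (σ : Equiv.Perm (Fin m)) :
    ∃! c : Fin m, (Equiv.addRight c).trans σ ∈ negativeOrders v := by
  obtain ⟨c, hc⟩ := Finite.exists_max fun c : Fin m => cyclicPartialSum v σ c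
  have hcmem : (Equiv.addRight c).trans σ ∈ negativeOrders v := by
    intro k hk0 hk
    refine lt_of_le_of_ne ?_ (cyclicPartialSum_ne_zero hv _ hk0 hk)
    rw [cyclicPartialSum_rotate, sub_nonpos]
    rcases lt_or_ge ((c : ℕ) + k) m with h | h
    · exact hc ⟨c + k, h⟩
    · have h' := hc ⟨c + k - m, by omega⟩
      rw [← Nat.add_sub_of_le h, cyclicPartialSum_add_self hv]
      exact h'
  exact ⟨c, hcmem, fun d hd => le_antisymm
      (not_lt.1 (not_lt_of_rotate_mem_negativeOrders hv hcmem hd))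
      (not_lt.1 (not_lt_of_rotate_mem_negativeOrders hv hd hcmem))⟩

lemma ncard_negativeOrders (hv : v ∈ genericDirections m) :
    (negativeOrders v).ncard = (m - 1).factorial := by
  have hbij : Function.Bijective fun p : negativeOrders v × Fin m =>
      (Equiv.addRight p.2).trans p.1.1 := by
    have hrot : ∀ (σ : Equiv.Perm (Fin m)) (c : Fin m),
        (Equiv.addRight (-c)).trans ((Equiv.addRight c).trans σ) = σ := by
      intro σ c
      ext i
      simp
    constructor
    · rintro ⟨⟨σ, hσ⟩, c⟩ ⟨⟨τ, hτ⟩, d⟩ h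
      have h : (Equiv.addRight c).trans σ = (Equiv.addRight d).trans τ := h
      have hcd : -c = -d :=
        (existsUnique_rotate_mem_negativeOrders hv ((Equiv.addRight c).trans σ)).unique
          (by rwa [hrot]) (by rwa [h, hrot])
      obtain rfl := neg_injective hcd
      have hστ : σ = τ := by rw [← hrot σ c, h, hrot]
      subst hστ
      rfl
    · intro τ
      obtain ⟨c, hc, -⟩ := existsUnique_rotate_mem_negativeOrders hv τ
      exact ⟨⟨⟨_, hc⟩, -c⟩, hrot τ c⟩
  have hcard := Nat.card_congr (Equiv.ofBijective _ hbij)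
  rw [Nat.card_prod, Nat.card_perm, Nat.card_fin, Nat.card_coe_set_eq,
    ← Nat.mul_factorial_pred (NeZero.ne m), mul_comm] at hcard
  exact Nat.eq_of_mul_eq_mul_left (NeZero.pos m) hcard

lemma sum_mul_nonpos_of_mem_negativeOrders (hv : v ∈ genericDirections m)
    {σ : Equiv.Perm (Fin m)} (hσ : σ ∈ negativeOrders v) {x : EuclideanSpace ℝ (Fin m)}
    (hx : x ∈ braidChamber σ) : ∑ i, v i * x i ≤ 0 := by
  rw [← Equiv.sum_comp σ, ← sum_range_ofNat_eq_sum (fun i => v (σ i) * x (σ i))]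
  have h := Finset.sum_range_by_parts (fun j => x (σ (Fin.ofNat m j)))
    (fun j => v (σ (Fin.ofNat m j))) m
  have hm := cyclicPartialSum_self hv σ
  unfold cyclicPartialSum at hm
  simp only [smul_eq_mul, hm, mul_zero, zero_sub] at h
  simp_rw [mul_comm (v _)]
  rw [h, neg_nonpos]
  refine Finset.sum_nonneg fun j hj => ?_
  have hj := Finset.mem_range.1 hj
  refine mul_nonneg_of_nonpos_of_nonpos (sub_nonpos.2 (hx.2 _ _ ?_).le)
    (hσ (j + 1) (by omega) (by omega)).le
  rw [Fin.lt_def]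
  simp [Nat.mod_eq_of_lt (show j < m by omega), Nat.mod_eq_of_lt (show j + 1 < m by omega)]

lemma mem_rankingPattern_of_pos (hv : v ∈ genericDirections m) {σ : Equiv.Perm (Fin m)} {k : ℕ}
    (hk : k < m) (hpos : 0 < cyclicPartialSum v σ k) : σ ∈ rankingPattern v := by
  set P := cyclicPartialSum v σ k with hP
  set Q := ∑ i : Fin m, v (σ i) * (i : ℕ) with hQ
  obtain ⟨ε, hε, hεQ⟩ : ∃ ε : ℝ, 0 < ε ∧ 0 ≤ 1 + ε * Q := by
    refine ⟨1 / (1 + |Q|), by positivity, ?_⟩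
    have h := neg_abs_le Q
    have h' : 1 + 1 / (1 + |Q|) * Q = (1 + |Q| + Q) / (1 + |Q|) := by field_simp
    rw [h']
    exact div_nonneg (by linarith) (by positivity)
  set A := (1 + ε * Q) / P with hA
  have hA0 : 0 ≤ A := div_nonneg hεQ hpos.le
  let y : Fin m → ℝ := fun j => (if (j : ℕ) < k then A else 0) - ε * (j : ℕ)
  let c : ℝ := (∑ j, y j) / m
  have hm0 : (m : ℝ) ≠ 0 := Nat.cast_ne_zero.2 (NeZero.ne m)
  have hx0 : ∑ i, (y (σ.symm i) - c) = 0 := by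
    rw [Equiv.sum_comp σ.symm (fun j => y j - c), Finset.sum_sub_distrib]
    simp [c, mul_div_cancel₀ _ hm0]
  refine ⟨WithLp.toLp 2 fun i => y (σ.symm i) - c, ⟨hx0, ?_⟩, hx0, ?_⟩
  · have hsum : ∑ j, v (σ j) * (y j - c) = A * P - ε * Q - c * ∑ j, v (σ j) := by
      rw [hP, ← sum_filter_perm_eq_cyclicPartialSum σ hk.le, hQ, Finset.sum_filter]
      simp only [Finset.mul_sum, ← Finset.sum_sub_distrib]
      refine Finset.sum_congr rfl fun j _ => ?_
      simp only [y]
      split_ifs <;> ring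
    have hv0 : ∑ j, v (σ j) = 0 := (Equiv.sum_comp σ (fun i => v i)).trans hv.1
    rw [← Equiv.sum_comp σ]
    simp only [Equiv.symm_apply_apply]
    rw [hsum, hv0, hA, div_mul_cancel₀ _ hpos.ne']
    ring
  · intro i j hij
    have hij' : (i : ℕ) < j := hij
    have hcast : ε * (i : ℕ) < ε * (j : ℕ) := by gcongr
    simp only [Equiv.symm_apply_apply, y]
    split_ifs <;> linarith

lemma compl_rankingPattern (hv : v ∈ genericDirections m) :
    (rankingPattern v)ᶜ = negativeOrders v := by
  ext σ
  refine ⟨fun h k hk0 hk => ?_, ?_⟩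
  · exact (not_lt.1 fun hpos => h (mem_rankingPattern_of_pos hv hk hpos)).lt_of_ne
      (cyclicPartialSum_ne_zero hv σ hk0 hk)
  · rintro h ⟨x, hxK, hxC⟩
    linarith [sum_mul_nonpos_of_mem_negativeOrders hv h hxC, hxK.2]

end

/-- For `v ∈ V`, exactly `(m-1)!` permutations are missing from `RP(v)`;
equivalently, `RP(v)` has cardinality `m! - (m-1)!`. -/
theorem card_rankingPattern {m : ℕ} (hm : 3 ≤ m)
    (v : EuclideanSpace ℝ (Fin m)) (hv : v ∈ genericDirections m) :
    (rankingPattern v)ᶜ.ncard = (m - 1).factorial ∧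
      (rankingPattern v).ncard = m.factorial - (m - 1).factorial := by
  have : NeZero m := ⟨by omega⟩
  have h : (rankingPattern v)ᶜ.ncard = (m - 1).factorial := by
    rw [compl_rankingPattern hv, ncard_negativeOrders hv]
  refine ⟨h, ?_⟩
  have hadd := Set.ncard_add_ncard_compl (rankingPattern v)
  rw [h, Nat.card_perm, Nat.card_fin] at hadd
  omega
end

section
/- Let m′ be a positive integer and let A be an m′×m′ real symmetric matrix that is indefinite, i.e., A has at least one positive eigenvalue and at least one negative eigenvalue. Then {tr(B A Bᵀ) : B ∈ GL(m′, ℝ)} = ℝ; that is, for every real number r there exists an invertible real m′×m′ matrix B with tr(B A Bᵀ) = r. -/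
open scoped BigOperators
open Matrix

/-- The matrix acting as multiplication by `a` on the range of `P`, by `b` on the range of `Q`,
and trivially on the intersection of their kernels, when `P` and `Q` are orthogonal idempotents. -/
def twoScaling {n : Type*} [DecidableEq n] (P Q : Matrix n n ℝ) (a b : ℝ) : Matrix n n ℝ :=
  1 + (a - 1) • P + (b - 1) • Q

lemma twoScaling_mul {n : Type*} [Fintype n] [DecidableEq n] {P Q : Matrix n n ℝ}
    (hP : P * P = P) (hQ : Q * Q = Q) (hPQ : P * Q = 0) (hQP : Q * P = 0) (a b c d : ℝ) :
    twoScaling P Q a b * twoScaling P Q c d = twoScaling P Q (a * c) (b * d) := by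
  simp only [twoScaling, add_mul, mul_add, one_mul, mul_one, smul_mul_assoc, mul_smul_comm,
    hP, hQ, hPQ, hQP, smul_zero]
  module

lemma isUnit_twoScaling {n : Type*} [Fintype n] [DecidableEq n] {P Q : Matrix n n ℝ}
    (hP : P * P = P) (hQ : Q * Q = Q) (hPQ : P * Q = 0) (hQP : Q * P = 0) {a b : ℝ}
    (ha : a ≠ 0) (hb : b ≠ 0) : IsUnit (twoScaling P Q a b) := by
  refine IsUnit.of_mul_eq_one (twoScaling P Q a⁻¹ b⁻¹) ?_
  rw [twoScaling_mul hP hQ hPQ hQP, mul_inv_cancel₀ ha, mul_inv_cancel₀ hb]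
  simp [twoScaling]

lemma dotProduct_eq_zero_of_mulVec_eq_smul {n : Type*} [Fintype n] {A : Matrix n n ℝ}
    (hA : Aᵀ = A) {c d : ℝ} {x y : n → ℝ} (hx : A *ᵥ x = c • x) (hy : A *ᵥ y = d • y)
    (hcd : c ≠ d) : x ⬝ᵥ y = 0 := by
  have h : c * (x ⬝ᵥ y) = d * (x ⬝ᵥ y) := by
    calc c * (x ⬝ᵥ y) = (A *ᵥ x) ⬝ᵥ y := by rw [hx, smul_dotProduct, smul_eq_mul]
      _ = x ⬝ᵥ (A *ᵥ y) := by rw [dotProduct_mulVec, ← mulVec_transpose, hA]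
      _ = d * (x ⬝ᵥ y) := by rw [hy, dotProduct_smul, smul_eq_mul]
  by_contra h0
  exact hcd (mul_right_cancel₀ h0 h)

/-- The orthogonal projection onto the line spanned by `x`. -/
noncomputable def lineProj {n : Type*} [Fintype n] (x : n → ℝ) : Matrix n n ℝ :=
  (x ⬝ᵥ x)⁻¹ • vecMulVec x x

section lineProj

variable {n : Type*} [Fintype n] {x y : n → ℝ}

lemma lineProj_mul_self (hx : x ≠ 0) : lineProj x * lineProj x = lineProj x := by
  have h : x ⬝ᵥ x ≠ 0 := fun h => hx (dotProduct_self_eq_zero.1 h)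
  simp [lineProj, vecMulVec_mul_vecMulVec, vecMulVec_smul, smul_smul, h]

lemma lineProj_mul_of_dotProduct_eq_zero (h : x ⬝ᵥ y = 0) : lineProj x * lineProj y = 0 := by
  simp [lineProj, vecMulVec_mul_vecMulVec, h]

lemma trace_lineProj (hx : x ≠ 0) : (lineProj x).trace = 1 := by
  have h : x ⬝ᵥ x ≠ 0 := fun h => hx (dotProduct_self_eq_zero.1 h)
  simp [lineProj, trace_vecMulVec, h]

lemma transpose_lineProj : (lineProj x)ᵀ = lineProj x := by
  simp [lineProj, transpose_vecMulVec]

lemma mul_lineProj_of_mulVec_eq_smul {A : Matrix n n ℝ} {c : ℝ} (h : A *ᵥ x = c • x) :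
    A * lineProj x = c • lineProj x := by
  rw [lineProj, mul_smul_comm, mul_vecMulVec, h, smul_vecMulVec, smul_comm]

end lineProj

lemma exists_ne_zero_sq_mul_add_sq_mul_eq {c d : ℝ} (hc : 0 < c) (hd : d < 0) (k : ℝ) :
    ∃ a b : ℝ, a ≠ 0 ∧ b ≠ 0 ∧ a * a * c + b * b * d = k := by
  have hp : 0 < (k + |k| + 1) / c := div_pos (by linarith [neg_abs_le k]) hc
  have hq : 0 < (|k| + 1) / -d := div_pos (by positivity) (by linarith)
  refine ⟨√((k + |k| + 1) / c), √((|k| + 1) / -d), (Real.sqrt_pos.2 hp).ne',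
    (Real.sqrt_pos.2 hq).ne', ?_⟩
  rw [Real.mul_self_sqrt hp.le, Real.mul_self_sqrt hq.le]
  have := hd.ne
  field_simp
  ring

/-- Lemma 4.3: if the real symmetric `m′×m′` matrix `A` is indefinite (it has a
positive eigenvalue and a negative eigenvalue), then
`{tr(B A Bᵀ) : B ∈ GL(m′, ℝ)} = ℝ`. -/
theorem trace_BABt_surjective {m' : ℕ} (hm' : 0 < m')
    (A : Matrix (Fin m') (Fin m') ℝ) (hsymm : A.IsHermitian)
    (hpos : ∃ (c : ℝ) (x : Fin m' → ℝ), 0 < c ∧ x ≠ 0 ∧ A.mulVec x = c • x)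
    (hneg : ∃ (c : ℝ) (x : Fin m' → ℝ), c < 0 ∧ x ≠ 0 ∧ A.mulVec x = c • x) :
    ∀ r : ℝ, ∃ B : Matrix (Fin m') (Fin m') ℝ, IsUnit B ∧ (B * A * Bᵀ).trace = r := by
  intro r
  obtain ⟨c, x, hc, hx0, hx⟩ := hpos
  obtain ⟨d, y, hd, hy0, hy⟩ := hneg
  have hA : Aᵀ = A := by simpa [IsHermitian] using hsymm
  have hxy : x ⬝ᵥ y = 0 := dotProduct_eq_zero_of_mulVec_eq_smul hA hx hy (hd.trans hc).ne'
  have hP := lineProj_mul_self hx0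
  have hQ := lineProj_mul_self hy0
  have hPQ := lineProj_mul_of_dotProduct_eq_zero hxy
  have hQP := lineProj_mul_of_dotProduct_eq_zero (dotProduct_comm x y ▸ hxy)
  obtain ⟨a, b, ha, hb, hab⟩ := exists_ne_zero_sq_mul_add_sq_mul_eq hc hd (r - A.trace + c + d)
  refine ⟨twoScaling (lineProj x) (lineProj y) a b,
    isUnit_twoScaling hP hQ hPQ hQP ha hb, ?_⟩
  have hT : (twoScaling (lineProj x) (lineProj y) a b)ᵀ =
      twoScaling (lineProj x) (lineProj y) a b := by
    simp [twoScaling, transpose_lineProj]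
  rw [hT, trace_mul_comm, ← mul_assoc, trace_mul_comm, twoScaling_mul hP hQ hPQ hQP]
  simp only [twoScaling, mul_add, mul_one, mul_smul_comm, mul_lineProj_of_mulVec_eq_smul hx,
    mul_lineProj_of_mulVec_eq_smul hy, trace_add, trace_smul, trace_lineProj hx0,
    trace_lineProj hy0, smul_eq_mul]
  linarith
end

section
/- Let m ≥ 3 and let v ∈ V have at least two positive entries and at least two negative entries. Then both RP(v) and RP(−v) can be realized as ranking patterns of unfolding models of codimension one: there exist generic μ_1,…,μ_m ∈ ℝ^{m−2} and generic μ′_1,…,μ′_m ∈ ℝ^{m−2} such that RP(v) = RP^UF(μ_1,…,μ_m) and RP(−v) = RP^UF(μ′_1,…,μ′_m). -/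
open scoped BigOperators

/-- Condition (A) for `m` points in a real vector space, with `N` edges. -/
def ConditionA {m : ℕ} (N : ℕ) {E : Type*} [AddCommGroup E] [Module ℝ E]
    (ν : Fin m → E) : Prop :=
  ∀ e : Fin N → Fin m × Fin m,
    (∀ k, (e k).1 ≠ (e k).2) →
    Function.Injective (fun k => s((e k).1, (e k).2)) →
    ((SimpleGraph.fromEdgeSet
        (Set.range fun k => s((e k).1, (e k).2))).IsAcyclic ↔
      LinearIndependent ℝ fun k => ν (e k).1 - ν (e k).2)

/-- Genericity of `μ₁,…,μ_m ∈ ℝ^{m-2}` : condition (A1) and condition (A2) for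
the lifted points `(μⱼ, ‖μⱼ‖²)`. -/
def Generic {m : ℕ} (μ : Fin m → EuclideanSpace ℝ (Fin (m - 2))) : Prop :=
  ConditionA (m - 2) μ ∧
    ConditionA (m - 1)
      (fun j => (μ j, ‖μ j‖ ^ 2) :
        Fin m → EuclideanSpace ℝ (Fin (m - 2)) × ℝ)

/-- The ranking pattern of the unfolding model with ideal objects `μ₁,…,μ_m`. -/
def rankingPatternUF {m n : ℕ} (μ : Fin m → EuclideanSpace ℝ (Fin n)) :
    Set (Equiv.Perm (Fin m)) :=
  {σ | ∃ y : EuclideanSpace ℝ (Fin n),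
    ∀ k l : Fin m, k < l → ‖y - μ (σ k)‖ < ‖y - μ (σ l)‖}

open scoped RealInnerProductSpace

section EdgeVectors

variable {ι V : Type*}

/-- The oriented incidence vector `e_a - e_b` of the ordered pair `(a, b)`. -/
def edgeVector [DecidableEq V] (p : V × V) : V → ℝ :=
  Pi.single p.1 1 - Pi.single p.2 1

theorem sum_edgeVector [DecidableEq V] (p : V × V) (I : Finset V) :
    ∑ j ∈ I, edgeVector p j = (if p.1 ∈ I then 1 else 0) - (if p.2 ∈ I then 1 else 0) := by
  simp [edgeVector, Finset.sum_sub_distrib]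

theorem sum_linearCombination_edgeVector [DecidableEq V] [Fintype ι] (e : ι → V × V) (c : ι → ℝ)
    (I : Finset V) :
    ∑ j ∈ I, (∑ k, c k • edgeVector (e k)) j =
      ∑ k, c k * ((if (e k).1 ∈ I then 1 else 0) - (if (e k).2 ∈ I then 1 else 0)) := by
  simp_rw [Finset.sum_apply, Pi.smul_apply, smul_eq_mul]
  rw [Finset.sum_comm]
  simp_rw [← Finset.mul_sum, sum_edgeVector]

theorem sum_linearCombination_edgeVector_smul [DecidableEq V] [Fintype ι] [Fintype V] {E : Type*}
    [AddCommGroup E] [Module ℝ E] (e : ι → V × V) (c : ι → ℝ) (ν : V → E) :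
    ∑ j, (∑ k, c k • edgeVector (e k)) j • ν j = ∑ k, c k • (ν (e k).1 - ν (e k).2) := by
  simp_rw [Finset.sum_apply, Pi.smul_apply, Finset.sum_smul]
  rw [Finset.sum_comm]
  refine Finset.sum_congr rfl fun k _ => ?_
  simp_rw [smul_assoc, ← Finset.smul_sum]
  simp [edgeVector, sub_smul, Finset.sum_sub_distrib, Pi.single_apply, ite_smul]

theorem linearIndependent_edgeVector_of_isAcyclic [DecidableEq V] [Fintype ι] [Fintype V] (e : ι → V × V)
    (hne : ∀ k, (e k).1 ≠ (e k).2)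
    (hinj : Function.Injective fun k => s((e k).1, (e k).2))
    (hG : (SimpleGraph.fromEdgeSet (Set.range fun k => s((e k).1, (e k).2))).IsAcyclic) :
    LinearIndependent ℝ fun k => edgeVector (e k) := by
  classical
  rw [Fintype.linearIndependent_iff]
  intro c hc k₀
  set G := SimpleGraph.fromEdgeSet (Set.range fun k => s((e k).1, (e k).2)) with hGdef
  have hadj : ∀ k, G.Adj (e k).1 (e k).2 := fun k =>
    (SimpleGraph.fromEdgeSet_adj _).2 ⟨⟨k, rfl⟩, hne k⟩
  have hbr := SimpleGraph.isBridge_iff.1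
    (SimpleGraph.isAcyclic_iff_forall_adj_isBridge.1 hG (hadj k₀))
  set G' := G.deleteEdges {s((e k₀).1, (e k₀).2)} with hG'
  have hadj' : ∀ k, k ≠ k₀ → G'.Adj (e k).1 (e k).2 := fun k hk => by
    rw [hG', SimpleGraph.deleteEdges_adj]
    exact ⟨hadj k, fun h => hk (hinj h)⟩
  have hsum := sum_linearCombination_edgeVector e c
    (Finset.univ.filter fun j => G'.Reachable (e k₀).1 j)
  rw [hc, Finset.sum_eq_single k₀] at hsum
  · simpa [hbr] using hsum.symm
  · intro k _ hk
    have hiff : G'.Reachable (e k₀).1 (e k).1 ↔ G'.Reachable (e k₀).1 (e k).2 :=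
      ⟨fun h => h.trans (hadj' k hk).reachable, fun h => h.trans (hadj' k hk).symm.reachable⟩
    simp [hiff]
  · simp

theorem isAcyclic_of_linearIndependent_sub {E : Type*} [AddCommGroup E] [Module ℝ E]
    (ν : V → E) (e : ι → V × V)
    (hν : LinearIndependent ℝ fun k => ν (e k).1 - ν (e k).2) :
    (SimpleGraph.fromEdgeSet (Set.range fun k => s((e k).1, (e k).2))).IsAcyclic := by
  rw [SimpleGraph.isAcyclic_iff_forall_adj_isBridge]
  intro a b hab
  rw [SimpleGraph.isBridge_iff]
  intro hreach
  obtain ⟨⟨k₀, hk₀⟩, -⟩ := (SimpleGraph.fromEdgeSet_adj _).1 hab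
  rw [linearIndependent_iff_notMem_span] at hν
  have hmem : ∀ a b, ((SimpleGraph.fromEdgeSet (Set.range fun k => s((e k).1, (e k).2))).deleteEdges
      {s((e k₀).1, (e k₀).2)}).Reachable a b →
      ν a - ν b ∈ Submodule.span ℝ ((fun k => ν (e k).1 - ν (e k).2) '' (Set.univ \ {k₀})) := by
    intro a b h
    rw [SimpleGraph.reachable_iff_reflTransGen] at h
    induction h with
    | refl => simp
    | @tail u w _ huw ih =>
      rw [← sub_add_sub_cancel _ (ν u)]
      refine add_mem ih ?_
      rw [SimpleGraph.deleteEdges_adj, SimpleGraph.fromEdgeSet_adj] at huw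
      obtain ⟨⟨⟨k, hk⟩, -⟩, hk'⟩ := huw
      have hkk : k ≠ k₀ := by
        rintro rfl
        exact hk' hk.symm
      have hspan := Submodule.subset_span (R := ℝ)
        (Set.mem_image_of_mem (fun k => ν (e k).1 - ν (e k).2)
          (show k ∈ Set.univ \ {k₀} from ⟨trivial, hkk⟩))
      rcases Sym2.eq_iff.1 hk with ⟨h1, h2⟩ | ⟨h1, h2⟩
      · simpa [h1, h2] using hspan
      · simpa [h1, h2] using neg_mem hspan
  rw [← hk₀] at hreach
  refine hν k₀ ?_
  rcases Sym2.eq_iff.1 hk₀ with ⟨h1, h2⟩ | ⟨h1, h2⟩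
  · exact hmem _ _ (by simpa only [h1, h2] using hreach)
  · exact hmem _ _ (by simpa only [h1, h2] using hreach.symm)

/-- With too few edges to connect the vertices, no combination of edge vectors is a vector all of
whose proper partial sums are nonzero. -/
theorem exists_sum_linearCombination_edgeVector_eq_zero [DecidableEq V] [Fintype ι] [Fintype V] [Nonempty V]
    (e : ι → V × V) (hcard : Fintype.card ι + 1 < Fintype.card V) (c : ι → ℝ) :
    ∃ I : Finset V, I.Nonempty ∧ I ≠ Finset.univ ∧
      ∑ j ∈ I, (∑ k, c k • edgeVector (e k)) j = 0 := by
  classical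
  set G := SimpleGraph.fromEdgeSet (Set.range fun k => s((e k).1, (e k).2)) with hGdef
  have hG : ¬ G.Connected := fun h => by
    have h1 := h.card_vert_le_card_edgeSet_add_one
    have h2 : Nat.card G.edgeSet ≤ Fintype.card ι := by
      rw [← Nat.card_eq_fintype_card]
      refine (Nat.card_mono (Set.finite_range _) ?_).trans
        (Finite.card_range_le fun k => s((e k).1, (e k).2))
      rw [hGdef, SimpleGraph.edgeSet_fromEdgeSet]
      exact Set.sdiff_subset
    rw [Nat.card_eq_fintype_card] at h1
    omega
  obtain ⟨a, b, hab⟩ : ∃ a b, ¬ G.Reachable a b := by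
    by_contra! h
    exact hG ⟨h⟩
  refine ⟨Finset.univ.filter fun j => G.Reachable a j, ⟨a, by simp⟩, fun h => hab ?_, ?_⟩
  · simpa using h.symm.subset (Finset.mem_univ b)
  · rw [sum_linearCombination_edgeVector]
    refine Finset.sum_eq_zero fun k _ => ?_
    have hreach : G.Reachable (e k).1 (e k).2 := by
      by_cases h : (e k).1 = (e k).2
      · rw [h]
      · exact SimpleGraph.Adj.reachable
          ((SimpleGraph.fromEdgeSet_adj _).2 ⟨⟨k, rfl⟩, h⟩)
    have hiff : G.Reachable a (e k).1 ↔ G.Reachable a (e k).2 :=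
      ⟨fun h => h.trans hreach, fun h => h.trans hreach.symm⟩
    simp [hiff]

end EdgeVectors

theorem ConditionA.of_forall_eq_zero {m N : ℕ} {E : Type*} [AddCommGroup E] [Module ℝ E]
    {ν : Fin m → E}
    (h : ∀ (e : Fin N → Fin m × Fin m) (c : Fin N → ℝ),
      ∑ j, (∑ k, c k • edgeVector (e k)) j • ν j = 0 → ∑ k, c k • edgeVector (e k) = 0) :
    ConditionA N ν := by
  refine fun e hne hinj => ⟨fun hG => ?_, isAcyclic_of_linearIndependent_sub ν e⟩
  rw [Fintype.linearIndependent_iff]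
  intro c hc
  rw [← sum_linearCombination_edgeVector_smul] at hc
  exact Fintype.linearIndependent_iff.1
    (linearIndependent_edgeVector_of_isAcyclic e hne hinj hG) c (h e c hc)

/-- Points with an injective affine-dependency map on the sum-zero vectors satisfy
condition (A). -/
theorem conditionA_of_ker_eq_bot {m N : ℕ} {E : Type*} [AddCommGroup E] [Module ℝ E]
    {ν : Fin m → E} (h : ∀ x : Fin m → ℝ, ∑ j, x j = 0 → ∑ j, x j • ν j = 0 → x = 0) :
    ConditionA N ν := by
  refine .of_forall_eq_zero fun e c hc => h _ ?_ hc
  rw [sum_linearCombination_edgeVector]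
  simp

/-- Points whose only affine dependencies are the multiples of a generic direction satisfy
condition (A) as long as the number of edges is too small to connect all the points. -/
theorem conditionA_of_ker_le_span {m N : ℕ} {E : Type*} [AddCommGroup E] [Module ℝ E]
    {ν : Fin m → E} (hN : N + 1 < m) {v : Fin m → ℝ}
    (hv : ∀ I : Finset (Fin m), I.Nonempty → I ≠ Finset.univ → ∑ i ∈ I, v i ≠ 0)
    (h : ∀ x : Fin m → ℝ, ∑ j, x j = 0 → ∑ j, x j • ν j = 0 → ∃ a : ℝ, x = a • v) :
    ConditionA N ν := by
  refine .of_forall_eq_zero fun e c hc => ?_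
  have : NeZero m := ⟨by omega⟩
  obtain ⟨I, hI, hI', hsum⟩ :=
    exists_sum_linearCombination_edgeVector_eq_zero e (by simpa using hN) c
  obtain ⟨a, ha⟩ := h _ (by rw [sum_linearCombination_edgeVector]; simp) hc
  rw [ha] at hsum ⊢
  simp_rw [Pi.smul_apply, smul_eq_mul, ← Finset.mul_sum] at hsum
  rw [(mul_eq_zero.1 hsum).resolve_right (hv I hI hI'), zero_smul]

section Rows

variable {m : ℕ}

private theorem inner_eq_sum (x y : EuclideanSpace ℝ (Fin m)) :
    ⟪x, y⟫ = ∑ j, x j * y j := by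
  simp [PiLp.inner_apply, mul_comm]

/-- A vector with two negative entries has a negative diagonal form somewhere on its orthogonal
complement within the sum-zero vectors. -/
theorem exists_orthogonal_sum_mul_sq_neg (hm : m ≠ 0) {v : EuclideanSpace ℝ (Fin m)}
    (hv : ∑ i, v i = 0) (hneg : ∃ i j : Fin m, i ≠ j ∧ v i < 0 ∧ v j < 0) :
    ∃ r : EuclideanSpace ℝ (Fin m), ∑ j, r j = 0 ∧ ∑ j, v j * r j = 0 ∧
      ∑ j, v j * r j ^ 2 < 0 := by
  obtain ⟨i, j, hij, hi, hj⟩ := hneg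
  have hm' : (m : ℝ) ≠ 0 := by exact_mod_cast hm
  set f : Fin m → ℝ := Pi.single i (v j) - Pi.single j (v i) with hf
  have hvf : ∑ k, v k * f k = 0 := by
    simp [hf, mul_sub, Finset.sum_sub_distrib, Pi.single_apply, mul_comm (v i)]
  have hvf2 : ∑ k, v k * f k ^ 2 < 0 := by
    have h : ∀ k, v k * f k ^ 2 =
        (if k = i then v i * v j ^ 2 else 0) + (if k = j then v j * v i ^ 2 else 0) := by
      intro k
      by_cases h1 : k = i
      · subst h1
        simp [hf, hij]
      · by_cases h2 : k = j
        · subst h2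
          simp [hf, h1]
        · simp [hf, h1, h2]
    simp_rw [h, Finset.sum_add_distrib, Finset.sum_ite_eq', Finset.mem_univ, if_true]
    have := mul_neg_of_neg_of_pos hi (pow_pos (neg_pos.2 hj) 2)
    have := mul_neg_of_neg_of_pos hj (pow_pos (neg_pos.2 hi) 2)
    nlinarith
  set s : ℝ := (∑ k, f k) / m
  refine ⟨WithLp.toLp 2 fun k => f k - s, ?_, ?_, ?_⟩
  · simp only [Finset.sum_sub_distrib, Finset.sum_const, Finset.card_univ, Fintype.card_fin,
      nsmul_eq_mul, s]
    field_simp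
    simp
  · simp only [mul_sub, Finset.sum_sub_distrib, ← Finset.sum_mul, hvf, hv]
    simp
  · have h : ∀ k, v k * (f k - s) ^ 2 = v k * f k ^ 2 - 2 * s * (v k * f k) + s ^ 2 * v k :=
      fun k => by ring
    simpa only [h, Finset.sum_add_distrib, Finset.sum_sub_distrib, ← Finset.mul_sum, hvf, hv,
      mul_zero, sub_zero, add_zero] using hvf2

theorem exists_family_span_eq_of_mem {E : Type*} [NormedAddCommGroup E] [InnerProductSpace ℝ E]
    [FiniteDimensional ℝ E] {U : Submodule ℝ E} {n : ℕ} (hn : 0 < n)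
    (hU : Module.finrank ℝ U = Fintype.card (Fin n)) {x : E} (hx : x ∈ U) (hx0 : x ≠ 0) :
    ∃ b : Fin n → E, (∀ a, b a ∈ U) ∧ U ≤ Submodule.span ℝ (Set.range b) ∧
      ∃ (z : Fin n) (c : ℝ), c ≠ 0 ∧ b z = c • x := by
  set p : U := ⟨x, hx⟩
  have hp0 : p ≠ 0 := fun h => hx0 (congrArg Subtype.val h)
  obtain ⟨b, hb⟩ := Orthonormal.exists_orthonormalBasis_extension_of_card_eq (𝕜 := ℝ) hU
    (v := fun _ : Fin n => (‖p‖⁻¹ : ℝ) • p) (s := {⟨0, hn⟩}) (by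
      refine ⟨fun i => ?_, fun i j hij => absurd (Subsingleton.elim i j) hij⟩
      simpa using norm_smul_inv_norm (𝕜 := ℝ) hp0)
  refine ⟨fun a => b a, fun a => (b a).2, fun y hy => ?_, ⟨0, hn⟩, ‖p‖⁻¹,
    inv_ne_zero (norm_ne_zero_iff.2 hp0), congrArg Subtype.val (hb _ rfl)⟩
  have hy' := congrArg Subtype.val (b.sum_repr ⟨y, hy⟩)
  simp only [AddSubmonoidClass.coe_finsetSum, Submodule.coe_smul] at hy'
  exact (Submodule.mem_span_range_iff_exists_fun ℝ).2 ⟨_, hy'⟩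

theorem exists_ne_zero_sum_sq_mul_neg {ι : Type*} [Fintype ι] {q : ι → ℝ} {z : ι}
    (hz : q z < 0) : ∃ s : ι → ℝ, (∀ a, s a ≠ 0) ∧ ∑ a, s a ^ 2 * q a < 0 := by
  classical
  set C := ∑ a ∈ Finset.univ.erase z, q a
  have hpos : 0 < (|C| + 1) / -q z := div_pos (by positivity) (neg_pos.2 hz)
  set t := √((|C| + 1) / -q z) with ht
  have ht0 : t ≠ 0 := (Real.sqrt_pos.2 hpos).ne'
  have hneg : t ^ 2 * q z + C < 0 := by
    rw [ht, Real.sq_sqrt hpos.le, div_mul_eq_mul_div, div_neg, mul_div_cancel_right₀ _ hz.ne]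
    linarith [le_abs_self C]
  refine ⟨fun a => if a = z then t else 1, fun a => ?_, ?_⟩
  · by_cases h : a = z <;> simp [h, ht0]
  simp only
  rw [← Finset.add_sum_erase _ _ (Finset.mem_univ z), if_pos rfl]
  refine lt_of_eq_of_lt (congrArg (_ + ·) (Finset.sum_congr rfl fun a ha => ?_)) hneg
  simp [Finset.ne_of_mem_erase ha]

/-- There are `m - 2` vectors orthogonal to `v` which, together with the constant vectors, span the
orthogonal complement of `v`, and on which the form with diagonal `v` has negative trace. -/
theorem exists_rows (hm : 3 ≤ m) {v : EuclideanSpace ℝ (Fin m)} (hv : ∑ i, v i = 0) (hv0 : v ≠ 0)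
    {r₀ : EuclideanSpace ℝ (Fin m)} (hr₀ : ∑ j, r₀ j = 0) (hvr₀ : ∑ j, v j * r₀ j = 0)
    (hneg : ∑ j, v j * r₀ j ^ 2 < 0) :
    ∃ r : Fin (m - 2) → EuclideanSpace ℝ (Fin m),
      (∀ a, ⟪v, r a⟫ = 0) ∧
      (∀ x : EuclideanSpace ℝ (Fin m), ∑ j, x j = 0 → (∀ a, ⟪x, r a⟫ = 0) →
        ∃ α : ℝ, x = α • v) ∧
      ∑ a, ∑ j, v j * r a j ^ 2 < 0 := by
  set u : EuclideanSpace ℝ (Fin m) := WithLp.toLp 2 fun _ => 1 with hu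
  have hinner_u : ∀ x : EuclideanSpace ℝ (Fin m), ⟪x, u⟫ = ∑ j, x j := fun x => by
    simp [inner_eq_sum, hu]
  have hu0 : u ≠ 0 := fun h => by
    simpa [hu] using congrArg (fun x : EuclideanSpace ℝ (Fin m) => x ⟨0, by omega⟩) h
  set W : Submodule ℝ (EuclideanSpace ℝ (Fin m)) := Submodule.span ℝ {v, u} with hW
  have hvW : v ∈ W := Submodule.subset_span (by simp)
  have huW : u ∈ W := Submodule.subset_span (by simp)
  have hWrank : Module.finrank ℝ W = 2 := by
    have hli : LinearIndependent ℝ ![v, u] := by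
      refine linearIndependent_of_ne_zero_of_inner_eq_zero (𝕜 := ℝ) (fun i => ?_) fun i j hij => ?_
      · fin_cases i <;> simpa
      · have huv : ⟪v, u⟫ = 0 := by rw [hinner_u, hv]
        fin_cases i <;> fin_cases j <;> simp_all [real_inner_comm]
    have hrange : Set.range ![v, u] = {v, u} := by
      rw [Matrix.range_cons, Matrix.range_cons, Matrix.range_empty, Set.union_empty,
        Set.singleton_union]
    rw [hW, ← hrange, finrank_span_eq_card hli, Fintype.card_fin]
  have hUrank : Module.finrank ℝ Wᗮ = Fintype.card (Fin (m - 2)) :=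
    Submodule.finrank_add_finrank_orthogonal' (by simp [hWrank]; omega)
  have hr₀W : r₀ ∈ Wᗮ := by
    rw [Submodule.mem_orthogonal]
    intro x hx
    obtain ⟨α, β, rfl⟩ := Submodule.mem_span_pair.1 hx
    rw [inner_add_left, inner_smul_left, inner_smul_left, inner_eq_sum v, hvr₀, real_inner_comm,
      hinner_u, hr₀]
    simp
  have hr₀0 : r₀ ≠ 0 := by
    rintro rfl
    simp at hneg
  obtain ⟨b, hbU, hUb, z, c, hc, hbz⟩ := exists_family_span_eq_of_mem (by omega) hUrank hr₀W hr₀0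
  obtain ⟨s, hs, hsneg⟩ := exists_ne_zero_sum_sq_mul_neg (z := z)
    (q := fun a => ∑ j, v j * b a j ^ 2) (by
      have h : ∀ j, v j * b z j ^ 2 = c ^ 2 * (v j * r₀ j ^ 2) := fun j => by
        rw [hbz, PiLp.smul_apply, smul_eq_mul]
        ring
      simp_rw [h, ← Finset.mul_sum]
      exact mul_neg_of_pos_of_neg (by positivity) hneg)
  refine ⟨fun a => s a • b a, fun a => ?_, fun x hx hxr => ?_, lt_of_eq_of_lt ?_ hsneg⟩
  · rw [inner_smul_right, Submodule.inner_right_of_mem_orthogonal hvW (hbU a), mul_zero]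
  · have hxb : ∀ a, ⟪b a, x⟫ = 0 := fun a => by
      have h := hxr a
      rw [inner_smul_right] at h
      rw [real_inner_comm]
      exact (mul_eq_zero.1 h).resolve_left (hs a)
    have hxW : x ∈ Wᗮᗮ := by
      rw [Submodule.mem_orthogonal]
      intro y hy
      obtain ⟨d, rfl⟩ := (Submodule.mem_span_range_iff_exists_fun ℝ).1 (hUb hy)
      rw [sum_inner]
      exact Finset.sum_eq_zero fun a _ => by rw [inner_smul_left, hxb, mul_zero]
    rw [Submodule.orthogonal_orthogonal] at hxW
    obtain ⟨α, β, hαβ⟩ := Submodule.mem_span_pair.1 hxW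
    refine ⟨α, ?_⟩
    have hβ : β = 0 := by
      have h := hinner_u x
      rw [hx, ← hαβ, inner_add_left, inner_smul_left, inner_smul_left, hinner_u v, hv, mul_zero,
        zero_add] at h
      exact (mul_eq_zero.1 h).resolve_right (inner_self_ne_zero.2 hu0)
    rw [← hαβ, hβ, zero_smul, add_zero]
  · refine Finset.sum_congr rfl fun a _ => ?_
    rw [Finset.mul_sum]
    refine Finset.sum_congr rfl fun j _ => ?_
    rw [PiLp.smul_apply, smul_eq_mul]
    ring

/-- If the rows `r a`, modulo the constant vectors, have orthogonal complement `ℝ v`, then together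
with the constant vectors they span the orthogonal complement of `v`. -/
theorem exists_eq_const_add_sum {n : ℕ} {v : EuclideanSpace ℝ (Fin m)}
    {r : Fin n → EuclideanSpace ℝ (Fin m)}
    (hker : ∀ x : EuclideanSpace ℝ (Fin m), ∑ j, x j = 0 → (∀ a, ⟪x, r a⟫ = 0) →
      ∃ α : ℝ, x = α • v)
    {x : EuclideanSpace ℝ (Fin m)} (hx : ⟪v, x⟫ = 0) :
    ∃ (t : ℝ) (y : Fin n → ℝ), ∀ j, x j = t + ∑ a, y a * r a j := by
  set u : EuclideanSpace ℝ (Fin m) := WithLp.toLp 2 fun _ => 1 with hu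
  set S := Submodule.span ℝ (insert u (Set.range r)) with hS
  have hxS : x ∈ Sᗮᗮ := by
    rw [Submodule.mem_orthogonal]
    intro y hy
    obtain ⟨α, rfl⟩ := hker y
      (by simpa [inner_eq_sum, hu] using
        Submodule.inner_left_of_mem_orthogonal (Submodule.subset_span (Set.mem_insert _ _)) hy)
      (fun a => Submodule.inner_left_of_mem_orthogonal
        (Submodule.subset_span (Set.mem_insert_of_mem _ (Set.mem_range_self a))) hy)
    rw [inner_smul_left, hx, mul_zero]
  rw [Submodule.orthogonal_orthogonal, Submodule.mem_span_insert] at hxS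
  obtain ⟨t, z, hz, rfl⟩ := hxS
  obtain ⟨y, rfl⟩ := (Submodule.mem_span_range_iff_exists_fun ℝ).1 hz
  exact ⟨t, y, fun j => by simp [hu]⟩

end Rows

/-- Points whose affine dependencies are spanned by `v`, and
for which the `v`-weighted sum of squared norms is negative, realize the ranking pattern of `v`. -/
theorem rankingPattern_eq_rankingPatternUF {m n : ℕ} {v : EuclideanSpace ℝ (Fin m)}
    (hm : m ≠ 0) (hv : ∑ i, v i = 0) (μ : Fin m → EuclideanSpace ℝ (Fin n))
    (hμ : ∑ j, v j • μ j = 0) (hneg : ∑ j, v j * ‖μ j‖ ^ 2 < 0)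
    (hspan : ∀ x : EuclideanSpace ℝ (Fin m), ⟪v, x⟫ = 0 →
      ∃ (t : ℝ) (y : EuclideanSpace ℝ (Fin n)), ∀ j, x j = t + ⟪y, μ j⟫) :
    rankingPattern v = rankingPatternUF μ := by
  set c := -∑ j, v j * ‖μ j‖ ^ 2 with hc
  have hc0 : 0 < c := neg_pos.2 hneg
  have hm' : (m : ℝ) ≠ 0 := by exact_mod_cast hm
  ext σ
  constructor
  · rintro ⟨x, ⟨-, hvx⟩, -, hσ⟩
    obtain ⟨t, y, hy⟩ := hspan (WithLp.toLp 2 fun j => c * x j + ‖μ j‖ ^ 2) (by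
      simp only [inner_eq_sum, mul_add, Finset.sum_add_distrib, mul_left_comm _ c]
      rw [← Finset.mul_sum, hvx, hc, mul_one, neg_add_cancel])
    have hdist : ∀ j, ‖(1 / 2 : ℝ) • y - μ j‖ ^ 2 = ‖(1 / 2 : ℝ) • y‖ ^ 2 + t - c * x j := by
      intro j
      have h := hy j
      simp only at h
      rw [norm_sub_sq_real, inner_smul_left, ← sub_eq_iff_eq_add'.2 h]
      simp only [one_div, conj_trivial]
      ring
    refine ⟨(1 / 2 : ℝ) • y, fun k l hkl => ?_⟩
    refine lt_of_pow_lt_pow_left₀ 2 (norm_nonneg _) ?_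
    rw [hdist, hdist]
    linarith [mul_lt_mul_of_pos_left (hσ k l hkl) hc0]
  · rintro ⟨y, hy⟩
    set s := (∑ j, ‖y - μ j‖ ^ 2) / m with hs
    have hvy : ∑ j, v j * ‖y - μ j‖ ^ 2 = -c := by
      have h : ∀ j, v j * ‖y - μ j‖ ^ 2 =
          ‖y‖ ^ 2 * v j - 2 * ⟪y, v j • μ j⟫ + v j * ‖μ j‖ ^ 2 := fun j => by
        rw [norm_sub_sq_real, inner_smul_right]
        ring
      simp_rw [h, Finset.sum_add_distrib, Finset.sum_sub_distrib, ← Finset.mul_sum, ← inner_sum,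
        hμ, hv, hc]
      simp
    have hsum : ∑ j, (s - ‖y - μ j‖ ^ 2) / c = 0 := by
      rw [← Finset.sum_div, Finset.sum_sub_distrib, Finset.sum_const, Finset.card_univ,
        Fintype.card_fin, nsmul_eq_mul, hs, mul_div_cancel₀ _ hm', sub_self, zero_div]
    refine ⟨WithLp.toLp 2 fun j => (s - ‖y - μ j‖ ^ 2) / c, ⟨hsum, ?_⟩, hsum, fun k l hkl => ?_⟩
    · simp only [← mul_div_assoc, mul_sub, ← Finset.sum_div, Finset.sum_sub_distrib,
        ← Finset.sum_mul, hvy, hv]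
      field_simp
      ring
    · have h := pow_lt_pow_left₀ (hy k l hkl) (norm_nonneg _) two_ne_zero
      simp only
      gcongr

theorem exists_generic_rankingPattern_eq {m : ℕ} (hm : 3 ≤ m) {v : EuclideanSpace ℝ (Fin m)}
    (hv : v ∈ genericDirections m) (hneg : ∃ i j : Fin m, i ≠ j ∧ v i < 0 ∧ v j < 0) :
    ∃ μ : Fin m → EuclideanSpace ℝ (Fin (m - 2)),
      Generic μ ∧ rankingPattern v = rankingPatternUF μ := by
  obtain ⟨hv0, hnorm, hgen⟩ := hv
  obtain ⟨r₀, hr₀, hvr₀, hr₀neg⟩ := exists_orthogonal_sum_mul_sq_neg (by omega) hv0 hneg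
  obtain ⟨r, hvr, hker, hrneg⟩ := exists_rows hm hv0 (by rintro rfl; simp at hnorm) hr₀ hvr₀ hr₀neg
  set μ : Fin m → EuclideanSpace ℝ (Fin (m - 2)) := fun j => WithLp.toLp 2 fun a => r a j with hμ
  have hsmul : ∀ (x : Fin m → ℝ) (a), (∑ j, x j • μ j) a = ⟪WithLp.toLp 2 x, r a⟫ := fun x a => by
    simp [hμ, inner_eq_sum]
  have hkerμ : ∀ x : Fin m → ℝ, ∑ j, x j = 0 → ∑ j, x j • μ j = 0 → ∃ α : ℝ, x = α • ⇑v := by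
    intro x hx hxμ
    obtain ⟨α, hα⟩ := hker (WithLp.toLp 2 x) hx fun a => by rw [← hsmul, hxμ]; rfl
    exact ⟨α, funext fun j => congrArg (fun z : EuclideanSpace ℝ (Fin m) => z j) hα⟩
  have hsq : ∑ j, v j * ‖μ j‖ ^ 2 < 0 := by
    simp_rw [EuclideanSpace.real_norm_sq_eq, Finset.mul_sum]
    rw [Finset.sum_comm]
    exact hrneg
  refine ⟨μ, ⟨conditionA_of_ker_le_span (by omega) hgen hkerμ,
    conditionA_of_ker_eq_bot fun x hx hxν => ?_⟩,
    rankingPattern_eq_rankingPatternUF (by omega) hv0 μ ?_ hsq fun x hx => ?_⟩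
  · obtain ⟨α, rfl⟩ := hkerμ x hx (by simpa [Prod.fst_sum] using congrArg Prod.fst hxν)
    have h : ∑ j, (α • ⇑v) j * ‖μ j‖ ^ 2 = 0 := by
      simpa [Prod.snd_sum] using congrArg Prod.snd hxν
    simp_rw [Pi.smul_apply, smul_eq_mul, mul_assoc, ← Finset.mul_sum] at h
    rw [(mul_eq_zero.1 h).resolve_right hsq.ne, zero_smul]
  · ext a
    rw [hsmul]
    exact hvr a
  · obtain ⟨t, y, hy⟩ := exists_eq_const_add_sum hker hx
    refine ⟨t, WithLp.toLp 2 y, fun j => ?_⟩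
    rw [hy j, inner_eq_sum]

theorem neg_mem_genericDirections {m : ℕ} {v : EuclideanSpace ℝ (Fin m)}
    (hv : v ∈ genericDirections m) : -v ∈ genericDirections m := by
  obtain ⟨h0, h1, h2⟩ := hv
  exact ⟨by simp [h0], by simp [h1], fun I hI hI' => by simpa using h2 I hI hI'⟩

/-- Theorem 4.1, Part 1: if `v ∈ V` has at least two positive entries and at
least two negative entries, then both `RP(v)` and `RP(−v)` are realized as
ranking patterns of unfolding models of codimension one. -/
theorem rankingPattern_realizable_of_two_pos_two_neg {m : ℕ} (hm : 3 ≤ m)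
    (v : EuclideanSpace ℝ (Fin m)) (hv : v ∈ genericDirections m)
    (hpos : ∃ i j : Fin m, i ≠ j ∧ 0 < v i ∧ 0 < v j)
    (hneg : ∃ i j : Fin m, i ≠ j ∧ v i < 0 ∧ v j < 0) :
    (∃ μ : Fin m → EuclideanSpace ℝ (Fin (m - 2)),
        Generic μ ∧ rankingPattern v = rankingPatternUF μ) ∧
      (∃ μ' : Fin m → EuclideanSpace ℝ (Fin (m - 2)),
        Generic μ' ∧ rankingPattern (-v) = rankingPatternUF μ') := by
  obtain ⟨i, j, hij, hi, hj⟩ := hpos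
  exact ⟨exists_generic_rankingPattern_eq hm hv hneg,
    exists_generic_rankingPattern_eq hm (neg_mem_genericDirections hv)
      ⟨i, j, hij, by simpa using hi, by simpa using hj⟩⟩
end
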